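/- arXiv:1509.07458 — 5 statements merged into one kernel-verified Lean document; each statement's English description precedes it below -/
import Mathlib

section
/- Let d ≥ 1, U a d×d unitary, and for j,k ∈ {0,…,d−1} let M_{jk} = |jk⟩⟨b_{jk}| (U ⊗ I) act on the first two tensor factors of ℂ^d ⊗ ℂ^d ⊗ ℂ^d. Then for every vector ψ ∈ ℂ^d, (M_{jk} ⊗ I)( ψ ⊗ |Φ^{(d)}⟩ ) = (1/d) |jk⟩ ⊗ ( \overline{W_{jk}} U ψ ), where \overline{W_{jk}} denotes the entrywise complex conjugate of the Weyl operator W_{jk}. In particular, each measurement outcome (j,k) occurs with probability 1/d² for unit ψ, and the post-measurement state on the third system is (\overline{W_{jk}} U)ψ up to normalization. -/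
open Matrix Kronecker

/-- A unitary matrix preserves the sum of squared moduli of the coordinates. -/
theorem sum_normSq_mulVec_of_mem_unitaryGroup {n : Type*} [Fintype n] [DecidableEq n]
    {U : Matrix n n ℂ} (hU : U ∈ Matrix.unitaryGroup n ℂ) (v : n → ℂ) :
    ∑ i, Complex.normSq ((U *ᵥ v) i) = ∑ i, Complex.normSq (v i) := by
  have key (w : n → ℂ) : ((∑ i, Complex.normSq (w i) : ℝ) : ℂ) = star w ⬝ᵥ w := by
    simp [dotProduct, Complex.normSq_eq_conj_mul_self]
  have hstar : Uᴴ * U = 1 := Matrix.mem_unitaryGroup_iff'.mp hU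
  have h : ((∑ i, Complex.normSq ((U *ᵥ v) i) : ℝ) : ℂ) =
      ((∑ i, Complex.normSq (v i) : ℝ) : ℂ) := by
    rw [key, key, star_mulVec, ← dotProduct_mulVec, mulVec_mulVec, hstar, one_mulVec]
  exact_mod_cast h

/-- A translation matrix on `Fin d` with phases `c` preserves the sum of squared moduli. -/
theorem sum_normSq_shift_mulVec {d : ℕ} [NeZero d] (k : Fin d) (c : Fin d → ℂ)
    (hc : ∀ l, Complex.normSq (c l) = 1) (A : Matrix (Fin d) (Fin d) ℂ)
    (hA : ∀ i l, A i l = if i = k + l then c l else 0) (v : Fin d → ℂ) :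
    ∑ i, Complex.normSq ((A *ᵥ v) i) = ∑ i, Complex.normSq (v i) := by
  rw [← Equiv.sum_comp (Equiv.addLeft k) fun i => Complex.normSq ((A *ᵥ v) i)]
  refine Finset.sum_congr rfl fun l _ => ?_
  simp [mulVec, dotProduct, hA, hc]

/-- Key identity for incoherent implementation of a unitary `U`:
`(M_{jk} ⊗ I)(ψ ⊗ Φ^{(d)}) = (1/d) |jk⟩ ⊗ (conj(W_{jk}) U ψ)`, and for unit `ψ`
each outcome `(j,k)` occurs with probability `1/d²`. -/
theorem stmt_2 (d : ℕ) (hd : 1 ≤ d)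
    (τ : ℂ) (hτ : τ = Complex.exp (2 * Real.pi * Complex.I / d))
    (U : Matrix (Fin d) (Fin d) ℂ) (hU : U ∈ Matrix.unitaryGroup (Fin d) ℂ)
    (W : Fin d → Fin d → Matrix (Fin d) (Fin d) ℂ)
    (hW : ∀ j k i l, W j k i l = if i = k + l then τ ^ ((l : ℕ) * (j : ℕ)) else 0)
    (b : Fin d → Fin d → (Fin d × Fin d) → ℂ)
    (hb : ∀ j k (p : Fin d × Fin d),
      b j k p = ((1 / Real.sqrt d : ℝ) : ℂ) * W j k p.2 p.1)
    (M : Fin d → Fin d → Matrix (Fin d × Fin d) (Fin d × Fin d) ℂ)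
    (hM : ∀ j k, M j k =
      Matrix.vecMulVec (fun p : Fin d × Fin d => if p = (j, k) then 1 else 0)
        (fun q : Fin d × Fin d => (starRingEnd ℂ) (b j k q)) *
      (U ⊗ₖ (1 : Matrix (Fin d) (Fin d) ℂ)))
    (ψ : Fin d → ℂ) :
    (∀ (j k : Fin d) (p : Fin d × Fin d × Fin d),
      (∑ q : Fin d × Fin d, M j k (p.1, p.2.1) q *
          (ψ q.1 * (((1 / Real.sqrt d : ℝ) : ℂ) * (if q.2 = p.2.2 then 1 else 0))))
        = (1 / (d : ℂ)) * (if (p.1, p.2.1) = (j, k) then 1 else 0) *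
            (((W j k).map (starRingEnd ℂ) * U).mulVec ψ) p.2.2) ∧
    ((∑ a : Fin d, Complex.normSq (ψ a) = 1) → ∀ j k : Fin d,
      ∑ p : Fin d × Fin d × Fin d,
        Complex.normSq (∑ q : Fin d × Fin d, M j k (p.1, p.2.1) q *
          (ψ q.1 * (((1 / Real.sqrt d : ℝ) : ℂ) * (if q.2 = p.2.2 then 1 else 0))))
        = 1 / (d : ℝ) ^ 2) := by
  have hd0 : (d : ℝ) ≠ 0 := by positivity
  have hsq : ((1 / Real.sqrt d : ℝ) : ℂ) * ((1 / Real.sqrt d : ℝ) : ℂ) = 1 / (d : ℂ) := by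
    rw [← Complex.ofReal_mul, div_mul_div_comm, Real.mul_self_sqrt (Nat.cast_nonneg d)]
    simp
  have hMapply (j k : Fin d) (p q : Fin d × Fin d) : M j k p q =
      (if p = (j, k) then 1 else 0) * (((1 / Real.sqrt d : ℝ) : ℂ) *
        ((W j k).map (starRingEnd ℂ) * U) q.2 q.1) := by
    rw [hM, vecMulVec_mul, vecMulVec_apply]
    congr 1
    simp only [vecMul, dotProduct, Fintype.sum_prod_type, kroneckerMap_apply, one_apply, hb,
      map_mul, Complex.conj_ofReal, mul_ite, mul_one, mul_zero, Finset.sum_ite_eq',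
      Finset.mem_univ, if_true, mul_apply, map_apply, Finset.mul_sum, mul_assoc]
  have main (j k : Fin d) (p : Fin d × Fin d × Fin d) :
      (∑ q : Fin d × Fin d, M j k (p.1, p.2.1) q *
          (ψ q.1 * (((1 / Real.sqrt d : ℝ) : ℂ) * (if q.2 = p.2.2 then 1 else 0))))
        = (1 / (d : ℂ)) * (if (p.1, p.2.1) = (j, k) then 1 else 0) *
            (((W j k).map (starRingEnd ℂ) * U).mulVec ψ) p.2.2 := by
    simp only [hMapply, Fintype.sum_prod_type, mul_ite, mul_one, mul_zero, Finset.sum_ite_eq',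
      Finset.mem_univ, if_true, mulVec, dotProduct, Finset.mul_sum]
    refine Finset.sum_congr rfl fun a _ => ?_
    rw [← hsq]
    split_ifs <;> ring
  refine ⟨main, fun hψ j k => ?_⟩
  have : NeZero d := ⟨by lia⟩
  have hτ1 : Complex.normSq τ = 1 := by
    have h : 2 * Real.pi * Complex.I / d = ((2 * Real.pi / d : ℝ) : ℂ) * Complex.I := by
      push_cast
      ring
    rw [Complex.normSq_eq_norm_sq, hτ, h, Complex.norm_exp_ofReal_mul_I, one_pow]
  have hV : ∑ i, Complex.normSq ((((W j k).map (starRingEnd ℂ) * U) *ᵥ ψ) i) = 1 := by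
    rw [← mulVec_mulVec, sum_normSq_shift_mulVec k
      (fun l => (starRingEnd ℂ) (τ ^ ((l : ℕ) * (j : ℕ)))) ?_ _ ?_,
      sum_normSq_mulVec_of_mem_unitaryGroup hU, hψ]
    · intro l
      rw [Complex.normSq_conj, map_pow, hτ1, one_pow]
    · intro i l
      rw [map_apply, hW, apply_ite (starRingEnd ℂ), map_zero]
  simp only [main, map_mul, Fintype.sum_prod_type]
  simp [Prod.ext_iff, ite_and, apply_ite Complex.normSq, ← Finset.mul_sum]
  field_simp
  exact hV
end

section
/- Let ψ, φ : Fin n → ℝ be probability vectors with ψ_j > 0 for all j, let A be a finite index set, (p_α)_{α∈A} a probability distribution, and (σ_α)_{α∈A} permutations of Fin n such that ψ_j = ∑_{α∈A} p_α φ_{σ_α^{-1}(j)} for all j. Define the n×n matrices M_α with entries [M_α]_{ij} = √(p_α) · δ_{i, σ_α^{-1}(j)} · √(φ_i)/√(ψ_j). Then ∑_{α∈A} M_α^† M_α = I_n. -/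
open Matrix

/-- Completeness of the Kraus operators in the incoherent majorization lemma:
`∑_α M_α† M_α = I`. -/
theorem stmt_4 (n : ℕ) (ψ φ : Fin n → ℝ)
    (hψpos : ∀ j, 0 < ψ j) (hψsum : ∑ j, ψ j = 1)
    (hφpos : ∀ i, 0 ≤ φ i) (hφsum : ∑ i, φ i = 1)
    (A : Type) [Fintype A] (p : A → ℝ)
    (hp : ∀ α, 0 ≤ p α) (hpsum : ∑ α, p α = 1)
    (σ : A → Equiv.Perm (Fin n))
    (hmaj : ∀ j, ψ j = ∑ α, p α * φ ((σ α)⁻¹ j))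
    (M : A → Matrix (Fin n) (Fin n) ℂ)
    (hM : ∀ α i j, M α i j =
      if i = (σ α)⁻¹ j then
        ((Real.sqrt (p α) * (Real.sqrt (φ i) / Real.sqrt (ψ j)) : ℝ) : ℂ)
      else 0) :
    ∑ α, (M α)ᴴ * M α = 1 := by
  have gram_apply (α : A) (j k : Fin n) : ((M α)ᴴ * M α) j k =
      if j = k then ((p α * φ ((σ α)⁻¹ j) / ψ j : ℝ) : ℂ) else 0 := by
    rw [mul_apply, Finset.sum_eq_single ((σ α)⁻¹ j)]
    · rw [conjTranspose_apply, hM, hM, if_pos rfl]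
      by_cases hjk : j = k
      · subst hjk
        rw [if_pos rfl, if_pos rfl, Complex.star_def, Complex.conj_ofReal, ← Complex.ofReal_mul,
          ← sq, mul_pow, div_pow, Real.sq_sqrt (hp α), Real.sq_sqrt (hφpos _),
          Real.sq_sqrt (hψpos j).le, mul_div_assoc]
      · rw [if_neg hjk, if_neg fun h => hjk ((σ α)⁻¹.injective h), mul_zero]
    · intro i _ hi
      rw [conjTranspose_apply, hM, if_neg hi, star_zero, zero_mul]
    · exact fun h => absurd (Finset.mem_univ _) h
  ext j k
  simp only [Matrix.sum_apply, gram_apply, one_apply]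
  split_ifs
  · rw [← Complex.ofReal_sum, ← Finset.sum_div, ← hmaj, div_self (hψpos j).ne',
      Complex.ofReal_one]
  · exact Finset.sum_const_zero
end

section
/- Let ψ, φ : Fin n → ℝ be probability vectors with ψ_j > 0 for all j, let p_α > 0, and let σ_α be a permutation of Fin n. Define the n×n matrix M_α with entries [M_α]_{ij} = √(p_α) · δ_{i, σ_α^{-1}(j)} · √(φ_i)/√(ψ_j), and let P_α be the permutation matrix of σ_α^{-1} (i.e., P_α |j⟩ = |σ_α^{-1}(j)⟩). Then (M_α ⊗ P_α) ( ∑_{j} √(ψ_j) |j⟩ ⊗ |j⟩ ) = √(p_α) ∑_{i} √(φ_i) |i⟩ ⊗ |i⟩. In other words, upon obtaining outcome α of Alice's measurement and Bob applying the matching permutation, the maximally correlated state with Schmidt coefficients ψ is transformed exactly into the maximally correlated state with Schmidt coefficients φ. -/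
open Matrix

/-- Action of `(M_α ⊗ P_α)` on the maximally correlated state with Schmidt
coefficients `ψ`: it is mapped exactly to `√(p_α)` times the maximally
correlated state with Schmidt coefficients `φ`. -/
theorem stmt_5 (n : ℕ) (ψ φ : Fin n → ℝ)
    (hψpos : ∀ j, 0 < ψ j) (hψsum : ∑ j, ψ j = 1)
    (hφpos : ∀ i, 0 ≤ φ i) (hφsum : ∑ i, φ i = 1)
    (pα : ℝ) (hpα : 0 < pα)
    (σα : Equiv.Perm (Fin n))
    (M : Matrix (Fin n) (Fin n) ℂ)
    (hM : ∀ i j, M i j =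
      if i = σα⁻¹ j then
        ((Real.sqrt pα * (Real.sqrt (φ i) / Real.sqrt (ψ j)) : ℝ) : ℂ)
      else 0)
    (P : Matrix (Fin n) (Fin n) ℂ)
    (hP : ∀ i j, P i j = if i = σα⁻¹ j then 1 else 0) :
    ∀ i i' : Fin n,
      (∑ j : Fin n, ∑ j' : Fin n,
          M i j * P i' j' * (((Real.sqrt (ψ j) : ℝ) : ℂ) * (if j = j' then 1 else 0)))
        = ((Real.sqrt pα : ℝ) : ℂ) * ((Real.sqrt (φ i) : ℝ) : ℂ) *
            (if i = i' then 1 else 0) := by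
  intro i i'
  have hσ : ∀ k j : Fin n, k = σα⁻¹ j ↔ j = σα k := fun k j => by
    rw [Equiv.Perm.eq_inv_iff_eq, eq_comm]
  have hψ : ((Real.sqrt (ψ (σα i)) : ℝ) : ℂ) ≠ 0 :=
    Complex.ofReal_ne_zero.mpr (Real.sqrt_pos.mpr (hψpos _)).ne'
  simp only [mul_ite, mul_one, mul_zero, Finset.sum_ite_eq, Finset.mem_univ, if_true]
  rw [Finset.sum_eq_single (σα i)]
  · simp only [hM, hP, hσ, σα.injective.eq_iff, if_true]
    split_ifs
    · push_cast
      field_simp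
    · simp
  · intro j _ hj
    simp only [hM, hσ, hj, if_false, zero_mul]
  · simp
end

section
/- Let ψ, φ : Fin n → ℝ be probability vectors with ψ_j > 0 for all j, and suppose φ majorizes ψ, i.e., for every k ≤ n the sum of the k largest entries of φ is at least the sum of the k largest entries of ψ. Then there exist a finite index set A, a probability distribution (p_α)_{α∈A}, permutation matrices (P_α)_{α∈A} on ℂ^n, and n×n matrices (M_α)_{α∈A}, each M_α having at most one nonzero entry in every column, such that: (i) ∑_{α∈A} M_α^† M_α = I_n, and (ii) (M_α ⊗ P_α)( ∑_j √(ψ_j) |j⟩⊗|j⟩ ) = √(p_α) ∑_i √(φ_i) |i⟩⊗|i⟩ for every α ∈ A. In particular, the maximally correlated pure state with squared Schmidt coefficients ψ can be transformed with probability one into the one with squared Schmidt coefficients φ by a local incoherent measurement on Alice's side followed by a permutation on Bob's side conditioned on the outcome. -/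
open Matrix

/-- Summation by parts for an antitone `c` bounded below by `b`, when all partial sums of `d` are
nonnegative. -/
theorem mul_sum_le_sum_mul_of_antitone {n : ℕ} (c d : Fin n → ℝ) (hc : Antitone c)
    (hd : ∀ m : ℕ, 0 ≤ ∑ i : Fin n, if i.val < m then d i else 0) (b : ℝ) (hb : ∀ i, b ≤ c i) :
    b * ∑ i, d i ≤ ∑ i, c i * d i := by
  induction n generalizing b with
  | zero => simp
  | succ n ih =>
    have htot : 0 ≤ ∑ i, d i := by
      simpa only [Fin.is_lt, if_true] using hd (n + 1)
    have h := ih (fun i => c i.castSucc) (fun i => d i.castSucc)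
      (fun i j hij => hc (Fin.castSucc_le_castSucc_iff.2 hij))
      (fun m => by
        have h := hd (min m n)
        rw [Fin.sum_univ_castSucc] at h
        simpa using h)
      (c (Fin.last n)) (fun i => hc (Fin.le_last _))
    have h' := mul_le_mul_of_nonneg_right (hb (Fin.last n)) htot
    rw [Fin.sum_univ_castSucc] at h' ⊢
    rw [Fin.sum_univ_castSucc]
    linarith

/-- The initial segment carries the largest sum of an antitone family among all index sets of the
same cardinality. -/
theorem sum_le_sum_initial_of_antitone {n : ℕ} (g : Fin n → ℝ) (hg : Antitone g)
    (T : Finset (Fin n)) :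
    ∑ i ∈ T, g i ≤ ∑ i : Fin n, if i.val < T.card then g i else 0 := by
  obtain hT | hT := T.card.eq_zero_or_pos
  · simp [Finset.card_eq_zero.1 hT]
  have hTn : T.card ≤ n := by simpa using T.card_le_univ
  set t := g ⟨T.card - 1, by omega⟩
  have hcard : ((Finset.univ.filter fun i : Fin n => i.val < T.card).card : ℝ) = T.card := by
    rw [Fin.card_filter_val_lt, min_eq_right hTn]
  have key : ∑ i ∈ T, (g i - t) ≤
      ∑ i ∈ Finset.univ.filter fun i : Fin n => i.val < T.card, (g i - t) := by
    have hmem : ∑ i ∈ T, (g i - t) = ∑ i, if i ∈ T then g i - t else 0 := by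
      rw [Finset.sum_ite_mem, Finset.univ_inter]
    rw [hmem, Finset.sum_filter]
    refine Finset.sum_le_sum fun i _ => ?_
    by_cases hi : i.val < T.card
    · have : t ≤ g i := hg (Fin.le_def.2 (by simp; omega))
      split_ifs <;> linarith
    · have : g i ≤ t := hg (Fin.le_def.2 (by simp; omega))
      split_ifs <;> linarith
  rw [Finset.sum_sub_distrib, Finset.sum_sub_distrib, Finset.sum_const, Finset.sum_const,
    nsmul_eq_mul, nsmul_eq_mul, hcard] at key
  rw [← Finset.sum_filter]
  linarith

/-- If `φ` majorizes `ψ`, then any linear functional is at least as large at some rearrangement of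
`φ` as it is at `ψ`. -/
theorem exists_perm_sum_mul_le {n : ℕ} (ψ φ c : Fin n → ℝ) (hsum : ∑ j, ψ j = ∑ i, φ i)
    (hmaj : ∀ S : Finset (Fin n), ∃ T : Finset (Fin n),
      T.card = S.card ∧ ∑ j ∈ S, ψ j ≤ ∑ i ∈ T, φ i) :
    ∃ σ : Equiv.Perm (Fin n), ∑ j, c j * ψ j ≤ ∑ j, c j * φ (σ j) := by
  set τ := Tuple.sort (-c)
  set ρ := Tuple.sort (-φ)
  have hτ : Antitone fun i => c (τ i) := fun i j hij => by
    simpa using Tuple.monotone_sort (-c) hij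
  have hρ : Antitone fun i => φ (ρ i) := fun i j hij => by
    simpa using Tuple.monotone_sort (-φ) hij
  have hpartial (m : ℕ) :
      0 ≤ ∑ i : Fin n, if i.val < m then φ (ρ i) - ψ (τ i) else 0 := by
    obtain ⟨T, hT, hle⟩ :=
      hmaj ((Finset.univ.filter fun i : Fin n => i.val < m).map τ.toEmbedding)
    have h := sum_le_sum_initial_of_antitone _ hρ (T.map ρ.symm.toEmbedding)
    simp only [Finset.sum_map, Finset.card_map, Equiv.coe_toEmbedding,
      Equiv.apply_symm_apply, Fin.card_filter_val_lt] at h hle hT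
    rw [hT] at h
    simp only [lt_min_iff, Fin.is_lt, true_and] at h
    rw [← Finset.sum_filter] at h ⊢
    rw [Finset.sum_sub_distrib]
    linarith
  obtain ⟨b, hb⟩ := (Set.finite_range fun i => c (τ i)).bddBelow
  have h := mul_sum_le_sum_mul_of_antitone _ _ hτ hpartial b fun i => hb ⟨i, rfl⟩
  have htot : ∑ i, (φ (ρ i) - ψ (τ i)) = 0 := by
    rw [Finset.sum_sub_distrib, Equiv.sum_comp ρ φ, Equiv.sum_comp τ ψ, hsum, sub_self]
  simp only [htot, mul_zero, mul_sub, Finset.sum_sub_distrib] at h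
  refine ⟨τ.symm.trans ρ, ?_⟩
  rw [← Equiv.sum_comp τ fun j => c j * ψ j, ← Equiv.sum_comp τ fun j => c j * φ _]
  simp only [Equiv.trans_apply, Equiv.symm_apply_apply]
  linarith

/-- **Rado's theorem**: a vector majorized by `φ` lies in the convex hull of the rearrangements of
`φ`. -/
theorem mem_convexHull_range_perm {n : ℕ} (ψ φ : Fin n → ℝ) (hsum : ∑ j, ψ j = ∑ i, φ i)
    (hmaj : ∀ S : Finset (Fin n), ∃ T : Finset (Fin n),
      T.card = S.card ∧ ∑ j ∈ S, ψ j ≤ ∑ i ∈ T, φ i) :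
    ψ ∈ convexHull ℝ (Set.range fun σ : Equiv.Perm (Fin n) => φ ∘ σ) := by
  by_contra hψ
  obtain ⟨f, u, hlt, hu⟩ := geometric_hahn_banach_closed_point (convex_convexHull ℝ _)
    ((Set.finite_range _).isCompact_convexHull ℝ).isClosed hψ
  have hf (x : Fin n → ℝ) : f x = ∑ j, f (fun k => if j = k then 1 else 0) * x j := by
    simpa [mul_comm] using LinearMap.pi_apply_eq_sum_univ f.toLinearMap x
  obtain ⟨σ, hσ⟩ := exists_perm_sum_mul_le ψ φ _ hsum hmaj
  have h := hlt (φ ∘ σ) (subset_convexHull ℝ _ ⟨σ, rfl⟩)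
  rw [hf] at h hu
  exact absurd (hu.trans_le hσ) h.not_gt

/-- Incoherent analogue of Nielsen's majorization theorem (achievability): if `φ`
majorizes `ψ` then there is a complete family of incoherent Kraus operators
`M_α` (at most one nonzero entry in every column) together with permutations
`π_α` for Bob such that `(M_α ⊗ P_α)` maps the maximally correlated state with
squared Schmidt coefficients `ψ` to `√(p_α)` times the one with coefficients
`φ`. -/
theorem stmt_6 (n : ℕ) (ψ φ : Fin n → ℝ)
    (hψpos : ∀ j, 0 < ψ j) (hψsum : ∑ j, ψ j = 1)
    (hφpos : ∀ i, 0 ≤ φ i) (hφsum : ∑ i, φ i = 1)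
    (hmaj : ∀ S : Finset (Fin n), ∃ T : Finset (Fin n),
      T.card = S.card ∧ ∑ j ∈ S, ψ j ≤ ∑ i ∈ T, φ i) :
    ∃ (A : Type) (_ : Fintype A) (p : A → ℝ) (π : A → Equiv.Perm (Fin n))
      (M : A → Matrix (Fin n) (Fin n) ℂ),
      (∀ α, 0 ≤ p α) ∧ (∑ α, p α = 1) ∧
      (∀ α (j i i' : Fin n), M α i j ≠ 0 → M α i' j ≠ 0 → i = i') ∧
      (∑ α, (M α)ᴴ * M α = 1) ∧
      (∀ α (i i' : Fin n),
        (∑ j : Fin n, ∑ j' : Fin n,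
            M α i j * (if i' = π α j' then 1 else 0) *
              (((Real.sqrt (ψ j) : ℝ) : ℂ) * (if j = j' then 1 else 0)))
          = ((Real.sqrt (p α) : ℝ) : ℂ) * ((Real.sqrt (φ i) : ℝ) : ℂ) *
              (if i = i' then 1 else 0)) := by
  obtain ⟨A, hA, p, z, hp, hpsum, hz, hzψ⟩ := mem_convexHull_iff_exists_fintype.1
    (mem_convexHull_range_perm ψ φ (hψsum.trans hφsum.symm) hmaj)
  choose π hπ using hz
  have hmix (j : Fin n) : ∑ α, p α * φ (π α j) = ψ j := by
    rw [← hzψ]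
    simp [← hπ]
  refine ⟨A, hA, p, π, fun α => Matrix.of fun i j =>
    if i = π α j then ((√(p α) * √(φ i) / √(ψ j) : ℝ) : ℂ) else 0, hp, hpsum, ?_, ?_, ?_⟩
  · intro α j i i' hi hi'
    simp only [of_apply, ne_eq, ite_eq_right_iff, not_forall] at hi hi'
    exact hi.1.trans hi'.1.symm
  · ext j k
    simp only [Matrix.sum_apply, mul_apply, conjTranspose_apply, of_apply]
    by_cases hjk : j = k
    · subst hjk
      have hterm (α : A) : ((√(p α) * √(φ (π α j)) / √(ψ j)) * (√(p α) * √(φ (π α j)) / √(ψ j)))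
          = p α * φ (π α j) / ψ j := by
        rw [div_mul_div_comm, mul_mul_mul_comm, Real.mul_self_sqrt (hp α),
          Real.mul_self_sqrt (hφpos _), Real.mul_self_sqrt (hψpos j).le]
      simp only [apply_ite star, star_zero, ite_mul, mul_ite, zero_mul, mul_zero,
        Finset.sum_ite_eq', Finset.mem_univ, if_true, one_apply_eq,
        Complex.star_def, Complex.conj_ofReal]
      simp only [← Complex.ofReal_mul, hterm]
      rw [← Complex.ofReal_sum, ← Finset.sum_div, hmix, div_self (hψpos j).ne', Complex.ofReal_one]
    · rw [one_apply_ne hjk]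
      refine Finset.sum_eq_zero fun α _ => Finset.sum_eq_zero fun i _ => ?_
      by_cases hi : i = π α j
      · rw [if_neg fun hk => hjk ((π α).injective (hi.symm.trans hk)), mul_zero]
      · rw [if_neg hi, star_zero, zero_mul]
  · intro α i i'
    have hne (j : Fin n) : ((√(ψ j) : ℝ) : ℂ) ≠ 0 :=
      Complex.ofReal_ne_zero.2 (Real.sqrt_pos.2 (hψpos j)).ne'
    have hi (j : Fin n) : i = π α j ↔ (π α).symm i = j := by
      rw [Equiv.symm_apply_eq]
    simp only [of_apply, mul_ite, mul_one, mul_zero, Finset.sum_ite_eq, Finset.mem_univ, if_true]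
    simp only [hi, ite_mul, zero_mul]
    rw [Finset.sum_eq_single ((π α).symm i)]
    · simp [hne, eq_comm]
    · intro j _ hj
      simp [hj.symm]
    · simp
end

section
/- Let X be a finite alphabet, p a probability distribution on X, n ≥ 1, and 0 < δ < (2|X|)^{-1}. Suppose q is an empirical type for n (i.e., n·q(a) ∈ ℕ for all a ∈ X with ∑_a q(a) = 1) satisfying |q(a) − p(a)| < δ for all a ∈ X (so that the type class T^n_q is contained in the δ-typical set of p). Then (n+1)^{-|X|} · 2^{n(H(p) − τ(δ))} ≤ |T^n_q| ≤ 2^{n(H(p) + τ(δ))}, where τ(δ) = −δ|X| log δ, H(p) = −∑_{a∈X} p(a) log p(a) is the Shannon entropy, logarithms are base 2, and T^n_q = { x^n ∈ X^n : N(a|x^n) = n·q(a) for all a ∈ X } with N(a|x^n) the number of occurrences of the symbol a in the sequence x^n. -/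
open scoped Classical

/-- The type class of a distribution `q` on `X` for block length `n`:
all sequences in which each symbol `a` occurs exactly `n·q(a)` times. -/
noncomputable def typeClass {X : Type} [Fintype X] (n : ℕ) (q : X → ℝ) :
    Finset (Fin n → X) :=
  Finset.univ.filter fun xn =>
    ∀ a : X, (((Finset.univ.filter fun i => xn i = a).card : ℝ) = n * q a)

open Real Finset

section TypeCounting

variable {X : Type} [Fintype X] {n : ℕ}

/-- The sequences in which each symbol `a` occurs exactly `m a` times. -/
noncomputable def countClass (n : ℕ) (m : X → ℕ) : Finset (Fin n → X) :=
  univ.filter fun x => ∀ a : X, (univ.filter fun i => x i = a).card = m a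

lemma mem_countClass {m : X → ℕ} {x : Fin n → X} :
    x ∈ countClass n m ↔ ∀ a : X, (univ.filter fun i => x i = a).card = m a := by
  simp [countClass]

lemma countClass_nonempty {m : X → ℕ} (hm : ∑ a, m a = n) : (countClass n m).Nonempty := by
  have e : Fin n ≃ Σ a : X, Fin (m a) := Fintype.equivOfCardEq (by simp [hm])
  refine ⟨fun i => (e i).1, mem_countClass.2 fun a => ?_⟩
  rw [← Fintype.card_subtype]
  calc Fintype.card {i // (e i).1 = a}
      = Fintype.card {s : Σ a : X, Fin (m a) // s.1 = a} :=
        Fintype.card_congr (e.subtypeEquiv fun _ => Iff.rfl)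
    _ = Fintype.card (Fin (m a)) := Fintype.card_congr (Equiv.sigmaSubtype a)
    _ = m a := Fintype.card_fin _

lemma exists_perm_comp_eq {m : X → ℕ} {x y : Fin n → X}
    (hx : x ∈ countClass n m) (hy : y ∈ countClass n m) :
    ∃ g : Equiv.Perm (Fin n), x ∘ g = y := by
  rw [mem_countClass] at hx hy
  have e : ∀ a : X, {i // y i = a} ≃ {i // x i = a} := fun a =>
    Fintype.equivOfCardEq (by rw [Fintype.card_subtype, Fintype.card_subtype, hx, hy])
  exact ⟨Equiv.ofFiberEquiv e, funext fun i => Equiv.ofFiberEquiv_map e i⟩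

lemma comp_perm_mem_countClass {m : X → ℕ} {x : Fin n → X} (hx : x ∈ countClass n m)
    (g : Equiv.Perm (Fin n)) : x ∘ g ∈ countClass n m := by
  rw [mem_countClass] at hx ⊢
  intro a
  rw [← hx a, ← Fintype.card_subtype, ← Fintype.card_subtype]
  exact Fintype.card_congr (g.subtypeEquiv fun _ => Iff.rfl)

lemma card_countClass_mul_prod_factorial {m : X → ℕ} (hne : (countClass n m).Nonempty) :
    (countClass n m).card * ∏ a, (m a).factorial = n.factorial := by
  obtain ⟨x, hx⟩ := hne
  have h := card_eq_sum_card_fiberwise (s := (univ : Finset (Equiv.Perm (Fin n))))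
    (f := fun g : Equiv.Perm (Fin n) => x ∘ g) (t := countClass n m) fun g _ => comp_perm_mem_countClass hx g
  rw [card_univ, Fintype.card_perm, Fintype.card_fin] at h
  rw [h, ← smul_eq_mul, ← sum_const]
  refine sum_congr rfl fun y hy => ?_
  obtain ⟨g₀, rfl⟩ := exists_perm_comp_eq hx hy
  have hs := DomMulAct.stabilizer_card x
  rw [mem_countClass] at hx
  simp only [Fintype.card_subtype, hx] at hs
  rw [← hs]
  refine card_bij (fun g _ => g * g₀) ?_ ?_ ?_
  · intro g hg
    simp only [mem_filter, mem_univ, true_and] at hg ⊢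
    rw [Equiv.Perm.coe_mul, ← Function.comp_assoc, hg]
  · intro g _ g' _ hgg'
    exact mul_right_cancel hgg'
  · intro g hg
    simp only [mem_filter, mem_univ, true_and] at hg
    refine ⟨g * g₀⁻¹, ?_, by simp⟩
    simp only [mem_filter, mem_univ, true_and]
    rw [Equiv.Perm.coe_mul, ← Function.comp_assoc, hg, Function.comp_assoc, ← Equiv.Perm.coe_mul]
    simp

lemma factorial_mul_pow_le_factorial_mul_pow (m k : ℕ) :
    m.factorial * m ^ k ≤ k.factorial * m ^ m := by
  rcases le_total m k with h | h
  · calc m.factorial * m ^ k = m.factorial * m ^ (k - m) * m ^ m := by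
          rw [mul_assoc, ← pow_add, Nat.sub_add_cancel h]
      _ ≤ _ := Nat.mul_le_mul_right _ (Nat.factorial_mul_pow_sub_le_factorial h)
  · calc m.factorial * m ^ k ≤ k.factorial * m ^ (m - k) * m ^ k :=
          Nat.mul_le_mul_right _ (by
            rw [← Nat.factorial_mul_descFactorial (Nat.sub_le m k), Nat.sub_sub_self h]
            exact Nat.mul_le_mul_left _ (Nat.descFactorial_le_pow _ _))
      _ = _ := by rw [mul_assoc, ← pow_add, Nat.sub_add_cancel h]

lemma card_countClass_mul_prod_pow_le {m k : X → ℕ} (hm : ∑ a, m a = n) :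
    (countClass n k).card * ∏ a, m a ^ k a ≤ (countClass n m).card * ∏ a, m a ^ m a := by
  rcases (countClass n k).eq_empty_or_nonempty with h | h
  · simp [h]
  have hk := card_countClass_mul_prod_factorial h
  have hm' := card_countClass_mul_prod_factorial (countClass_nonempty hm)
  have hle : ∏ a, ((m a).factorial * m a ^ k a) ≤ ∏ a, ((k a).factorial * m a ^ m a) :=
    prod_le_prod' fun a _ => factorial_mul_pow_le_factorial_mul_pow _ _
  rw [prod_mul_distrib, prod_mul_distrib] at hle
  have hpos : 0 < (∏ a, (k a).factorial) * ∏ a, (m a).factorial :=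
    Nat.mul_pos (prod_pos fun a _ => Nat.factorial_pos _) (prod_pos fun a _ => Nat.factorial_pos _)
  refine Nat.le_of_mul_le_mul_left ?_ hpos
  calc (∏ a, (k a).factorial) * (∏ a, (m a).factorial) *
        ((countClass n k).card * ∏ a, m a ^ k a)
      = ((countClass n k).card * ∏ a, (k a).factorial) *
        ((∏ a, (m a).factorial) * ∏ a, m a ^ k a) := by ring
    _ ≤ ((countClass n m).card * ∏ a, (m a).factorial) *
        ((∏ a, (k a).factorial) * ∏ a, m a ^ m a) := by
        rw [hk, hm']; exact Nat.mul_le_mul_left _ hle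
    _ = _ := by ring

lemma prod_apply_eq_prod_pow {q : X → ℝ} {m : X → ℕ} {x : Fin n → X}
    (hx : x ∈ countClass n m) : ∏ i, q (x i) = ∏ a, q a ^ m a := by
  rw [mem_countClass] at hx
  rw [← prod_fiberwise_of_maps_to (g := x) (t := univ) fun _ _ => mem_univ _]
  refine prod_congr rfl fun a _ => ?_
  rw [← hx a]
  exact prod_eq_pow_card fun i hi => by rw [(mem_filter.1 hi).2]

lemma sum_countClass_prod {q : X → ℝ} (m : X → ℕ) :
    ∑ x ∈ countClass n m, ∏ i, q (x i) = (countClass n m).card * ∏ a, q a ^ m a := by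
  rw [sum_congr rfl fun x hx => prod_apply_eq_prod_pow (q := q) hx, sum_const, nsmul_eq_mul]

lemma sum_prod_apply_eq_one {q : X → ℝ} (hq1 : ∑ a, q a = 1) :
    ∑ x : Fin n → X, ∏ i, q (x i) = 1 := by
  rw [← Fintype.sum_pow, hq1, one_pow]

lemma card_countClass_mul_prod_le_one {q : X → ℝ} (hq0 : ∀ a, 0 ≤ q a) (hq1 : ∑ a, q a = 1)
    (m : X → ℕ) : (countClass n m).card * ∏ a, q a ^ m a ≤ 1 := by
  rw [← sum_countClass_prod, ← sum_prod_apply_eq_one (n := n) hq1]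
  exact sum_le_sum_of_subset_of_nonneg (subset_univ _) fun x _ _ => prod_nonneg fun i _ => hq0 _

lemma one_le_pow_mul_card_countClass_mul_prod {m : X → ℕ} (hn : 1 ≤ n) (hm : ∑ a, m a = n) :
    1 ≤ ((n : ℝ) + 1) ^ Fintype.card X *
      ((countClass n m).card * ∏ a, ((m a : ℝ) / n) ^ m a) := by
  have hn0 : (0 : ℝ) < n := by exact_mod_cast hn
  set q : X → ℝ := fun a => (m a : ℝ) / n with hq
  have hq1 : ∑ a, q a = 1 := by
    rw [hq, ← sum_div, ← Nat.cast_sum, hm, div_self hn0.ne']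
  set K : Finset (X → ℕ) := Fintype.piFinset fun _ => range (n + 1) with hK
  have hclass : ∀ k : X → ℕ,
      ∑ x : Fin n → X with (fun a => (univ.filter fun i => x i = a).card) = k, ∏ i, q (x i) =
        (countClass n k).card * ∏ a, q a ^ k a := by
    intro k
    rw [← sum_countClass_prod]
    refine sum_congr ?_ fun _ _ => rfl
    ext x
    simp [mem_countClass, funext_iff]
  have hbound : ∀ k : X → ℕ, (countClass n k).card * ∏ a, q a ^ k a ≤
      (countClass n m).card * ∏ a, q a ^ m a := by
    intro k
    rcases (countClass n k).eq_empty_or_nonempty with h | ⟨x, hx⟩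
    · rw [h, card_empty, Nat.cast_zero, zero_mul]
      positivity
    have hk : ∑ a, k a = n := by
      rw [mem_countClass] at hx
      simp only [← hx]
      rw [← card_eq_sum_card_fiberwise (f := x) (s := univ) (t := univ) fun _ _ => by simp,
        card_univ, Fintype.card_fin]
    have hle : ((countClass n k).card : ℝ) * ∏ a, (m a : ℝ) ^ k a ≤
        (countClass n m).card * ∏ a, (m a : ℝ) ^ m a := by
      exact_mod_cast card_countClass_mul_prod_pow_le (k := k) hm
    simp only [hq, div_pow, prod_div_distrib, prod_pow_eq_pow_sum, hk, hm]
    rw [← mul_div_assoc, ← mul_div_assoc]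
    gcongr
  calc (1 : ℝ) = ∑ x : Fin n → X, ∏ i, q (x i) := (sum_prod_apply_eq_one hq1).symm
    _ = ∑ k ∈ K, (countClass n k).card * ∏ a, q a ^ k a := by
        rw [← sum_fiberwise_of_maps_to (t := K)
          (g := fun (x : Fin n → X) a => (univ.filter fun i => x i = a).card)]
        · exact sum_congr rfl fun k _ => hclass k
        · intro x _
          simp only [hK, Fintype.mem_piFinset, mem_range]
          intro a
          exact Nat.lt_succ_of_le ((card_le_univ _).trans_eq (Fintype.card_fin n))
    _ ≤ ∑ k ∈ K, (countClass n m).card * ∏ a, q a ^ m a := sum_le_sum fun k _ => hbound k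
    _ = _ := by
        rw [sum_const, nsmul_eq_mul, hK, Fintype.card_piFinset]
        simp [hq]

end TypeCounting

section EntropyContinuity

lemma negMulLog_add_le {s t : ℝ} (hs : 0 ≤ s) (ht : 0 ≤ t) :
    negMulLog (s + t) ≤ negMulLog s + negMulLog t := by
  rcases hs.eq_or_lt with rfl | hs
  · simp
  rcases ht.eq_or_lt with rfl | ht
  · simp
  have h1 := log_le_log hs (by linarith : s ≤ s + t)
  have h2 := log_le_log ht (by linarith : t ≤ s + t)
  simp only [negMulLog]
  nlinarith

lemma negMulLog_sub_negMulLog_add_le {t d : ℝ} (ht : 0 ≤ t) (hd : 0 ≤ d) (htd : t + d ≤ 1) :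
    negMulLog t - negMulLog (t + d) ≤ d := by
  have h1 : (t + d) * log (t + d) ≤ t * log (t + d) := by
    have := log_nonpos (by linarith) htd
    nlinarith
  rcases ht.eq_or_lt with rfl | ht
  · simp only [negMulLog] at *
    simp at *
    linarith
  have h2 : log (t + d) - log t ≤ d / t := by
    rw [← log_div (by positivity) (by positivity)]
    refine (log_le_sub_one_of_pos (by positivity)).trans_eq ?_
    field_simp
    ring
  have h3 : t * (log (t + d) - log t) ≤ d := by
    calc _ ≤ t * (d / t) := by gcongr
      _ = d := by field_simp
  simp only [negMulLog]
  linarith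

lemma log_le_neg_one_of_le_quarter {δ : ℝ} (hδ0 : 0 < δ) (hδ : δ ≤ 1 / 4) : log δ ≤ -1 := by
  rw [log_le_iff_le_exp hδ0, exp_neg]
  refine hδ.trans ?_
  rw [one_div]
  exact inv_anti₀ (exp_pos 1) (by linarith [exp_one_lt_d9])

lemma negMulLog_le_negMulLog_of_le_quarter {d δ : ℝ} (hd : 0 ≤ d) (hdδ : d ≤ δ)
    (hδ0 : 0 < δ) (hδ : δ ≤ 1 / 4) : negMulLog d ≤ negMulLog δ := by
  have hl := log_le_neg_one_of_le_quarter hδ0 hδ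
  rcases hd.eq_or_lt with rfl | hd
  · simp only [negMulLog]
    nlinarith
  have h : d * (log δ - log d) ≤ δ - d := by
    rw [← log_div hδ0.ne' hd.ne']
    calc _ ≤ d * (δ / d - 1) := by
          gcongr
          exact log_le_sub_one_of_pos (by positivity)
      _ = δ - d := by field_simp
  simp only [negMulLog]
  nlinarith

lemma abs_negMulLog_sub_le {s t δ : ℝ} (hs0 : 0 ≤ s) (hs1 : s ≤ 1) (ht0 : 0 ≤ t) (ht1 : t ≤ 1)
    (hδ0 : 0 < δ) (hδ : δ ≤ 1 / 4) (hst : |s - t| ≤ δ) :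
    |negMulLog s - negMulLog t| ≤ negMulLog δ := by
  wlog h : t ≤ s generalizing s t
  · rw [abs_sub_comm]
    exact this ht0 ht1 hs0 hs1 (by rwa [abs_sub_comm]) (le_of_not_ge h)
  obtain ⟨d, hd, rfl⟩ : ∃ d, 0 ≤ d ∧ s = t + d := ⟨s - t, by linarith, by ring⟩
  have hdδ : d ≤ δ := by simpa [abs_of_nonneg hd] using hst
  have h1 := negMulLog_add_le ht0 hd
  have h2 := negMulLog_sub_negMulLog_add_le ht0 hd hs1
  have h3 := negMulLog_le_negMulLog_of_le_quarter hd hdδ hδ0 hδ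
  have h4 : δ ≤ negMulLog δ := by
    have := log_le_neg_one_of_le_quarter hδ0 hδ
    simp only [negMulLog]
    nlinarith
  rw [abs_le]
  constructor <;> linarith

lemma abs_sum_negMulLog_sub_le {X : Type} [Fintype X] {p q : X → ℝ} (hp0 : ∀ a, 0 ≤ p a)
    (hp1 : ∑ a, p a = 1) (hq0 : ∀ a, 0 ≤ q a) (hq1 : ∑ a, q a = 1) {δ : ℝ} (hδ0 : 0 < δ)
    (hδ1 : δ < ((2 * Fintype.card X : ℝ))⁻¹) (hqp : ∀ a, |q a - p a| < δ) :
    |∑ a, negMulLog (q a) - ∑ a, negMulLog (p a)| ≤ Fintype.card X * negMulLog δ := by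
  have hle : ∀ {r : X → ℝ}, (∀ a, 0 ≤ r a) → ∑ a, r a = 1 → ∀ a, r a ≤ 1 := fun h0 h1 a =>
    h1 ▸ single_le_sum (fun b _ => h0 b) (mem_univ a)
  have hterm : ∀ a, |negMulLog (q a) - negMulLog (p a)| ≤ negMulLog δ := by
    intro a
    rcases subsingleton_or_nontrivial X with hX | hX
    · have hone : ∀ r : X → ℝ, ∑ b, r b = r a := fun r => Fintype.sum_subsingleton r a
      rw [hone] at hp1 hq1
      have hc : Fintype.card X = 1 := Fintype.card_eq_one_iff.2 ⟨a, fun b => Subsingleton.elim b a⟩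
      rw [hp1, hq1, sub_self, abs_zero]
      rw [hc] at hδ1
      exact negMulLog_nonneg hδ0.le (hδ1.le.trans (by norm_num))
    · have hc : (2 : ℝ) ≤ Fintype.card X := by exact_mod_cast Fintype.one_lt_card (α := X)
      refine abs_negMulLog_sub_le (hq0 a) (hle hq0 hq1 a) (hp0 a) (hle hp0 hp1 a) hδ0 ?_ (hqp a).le
      refine hδ1.le.trans ?_
      rw [one_div]
      exact inv_anti₀ (by norm_num) (by linarith)
  rw [← sum_sub_distrib]
  refine (abs_sum_le_sum_abs _ _).trans ((sum_le_sum fun a _ => hterm a).trans_eq ?_)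
  simp

end EntropyContinuity

lemma prod_div_pow_eq_exp {X : Type} [Fintype X] {n : ℕ} (hn : 1 ≤ n) (m : X → ℕ) :
    ∏ a, ((m a : ℝ) / n) ^ m a = exp (-(n * ∑ a, negMulLog ((m a : ℝ) / n))) := by
  have hn0 : (n : ℝ) ≠ 0 := by exact_mod_cast (by lia : n ≠ 0)
  rw [mul_sum, ← sum_neg_distrib, exp_sum]
  refine prod_congr rfl fun a _ => ?_
  rcases Nat.eq_zero_or_pos (m a) with h | h
  · simp [h]
  have hpos : (0 : ℝ) < (m a : ℝ) / n := by positivity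
  have : -(n * negMulLog ((m a : ℝ) / n)) = m a * log ((m a : ℝ) / n) := by
    simp only [negMulLog]
    field_simp
  rw [this, exp_nat_mul, exp_log hpos]

/-- Cardinality bounds on type classes of types `q` that are `δ`-typical for
`p`: `(n+1)^{-|X|} 2^{n(H(p)−τ(δ))} ≤ |T^n_q| ≤ 2^{n(H(p)+τ(δ))}` with
`τ(δ) = −δ|X| log δ` (base-2 logarithms). -/
theorem stmt_8 {X : Type} [Fintype X] [DecidableEq X]
    (p : X → ℝ) (hp0 : ∀ a, 0 ≤ p a) (hp1 : ∑ a, p a = 1)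
    (n : ℕ) (hn : 1 ≤ n)
    (δ : ℝ) (hδ0 : 0 < δ) (hδ1 : δ < ((2 * Fintype.card X : ℝ))⁻¹)
    (q : X → ℝ) (hq : ∀ a, ∃ m : ℕ, q a = (m : ℝ) / n) (hq1 : ∑ a, q a = 1)
    (hqp : ∀ a, |q a - p a| < δ) :
    (((n : ℝ) + 1) ^ (Fintype.card X))⁻¹ *
        (2 : ℝ) ^ ((n : ℝ) * ((-∑ a, p a * Real.logb 2 (p a)) -
          (-δ * (Fintype.card X) * Real.logb 2 δ)))
      ≤ ((typeClass n q).card : ℝ) ∧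
    ((typeClass n q).card : ℝ) ≤
      (2 : ℝ) ^ ((n : ℝ) * ((-∑ a, p a * Real.logb 2 (p a)) +
        (-δ * (Fintype.card X) * Real.logb 2 δ))) := by
  have hn0 : (0 : ℝ) < n := by exact_mod_cast hn
  choose m hm using hq
  obtain rfl : q = fun a => (m a : ℝ) / n := funext hm
  have hq0 : ∀ a, 0 ≤ (m a : ℝ) / n := fun a => by positivity
  have hmn : ∑ a, m a = n := by
    rw [← sum_div, div_eq_one_iff_eq hn0.ne'] at hq1
    exact_mod_cast hq1
  have hT : typeClass n (fun a => (m a : ℝ) / n) = countClass n m := by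
    ext x
    simp only [typeClass, mem_filter, mem_univ, true_and, mem_countClass,
      mul_div_cancel₀ _ hn0.ne', Nat.cast_inj]
  have hH := abs_le.1 (abs_sum_negMulLog_sub_le hp0 hp1 hq0 hq1 hδ0 hδ1 hqp)
  have hlog : log 2 ≠ 0 := (log_pos one_lt_two).ne'
  have hent : -∑ a, p a * logb 2 (p a) = (∑ a, negMulLog (p a)) / log 2 := by
    rw [sum_div, ← sum_neg_distrib]
    refine sum_congr rfl fun a _ => ?_
    simp only [negMulLog, logb]
    ring
  have htau : -δ * (Fintype.card X) * logb 2 δ = Fintype.card X * negMulLog δ / log 2 := by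
    simp only [negMulLog, logb]
    ring
  have hexp : ∀ u : ℝ, (2 : ℝ) ^ ((n : ℝ) * (u / log 2)) = exp (n * u) := by
    intro u
    rw [rpow_def_of_pos two_pos]
    congr 1
    field_simp
  have hupper := card_countClass_mul_prod_le_one (n := n) hq0 hq1 m
  have hlower := one_le_pow_mul_card_countClass_mul_prod hn hmn
  rw [prod_div_pow_eq_exp hn, exp_neg] at hupper hlower
  rw [hT, hent, htau, ← sub_div, ← add_div, hexp, hexp]
  constructor
  · rw [inv_mul_le_iff₀ (by positivity)]
    rw [← mul_assoc, ← div_eq_mul_inv, one_le_div (exp_pos _)] at hlower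
    refine le_trans (exp_le_exp.2 ?_) hlower
    gcongr
    linarith
  · rw [← div_eq_mul_inv, div_le_one (exp_pos _)] at hupper
    refine hupper.trans (exp_le_exp.2 ?_)
    gcongr
    linarith
end
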